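/- arXiv:1102.1854 — 8 statements merged into one kernel-verified Lean document; each statement's English description precedes it below -/
import Mathlib

section
/- Let ζ ∈ ℂ satisfy ζ² + ζ + 1 = 0. For all rational numbers a₁,a₂,a₃,b₁,b₂,b₃,c₁,c₂,c₃, the determinant of the 3×3 complex matrix M = [[a₁+b₂+b₃+c₂+c₃, −b₃−ζc₃, −b₂−ζ²c₂], [−b₃−ζ²c₃, a₂+b₁+b₃+c₁+c₃, −b₁−ζc₁], [−b₂−ζc₂, −b₁−ζ²c₁, a₃+b₁+b₂+c₁+c₂]] equals a₁a₂a₃ + Σ_{1≤i<j≤3} aᵢaⱼ(bᵢ+bⱼ+cᵢ+cⱼ) + (Σ_{1≤i<j≤3} bᵢbⱼ)·(a₁+a₂+a₃+3(c₁+c₂+c₃)) + (Σ_{1≤i<j≤3} cᵢcⱼ)·(a₁+a₂+a₃+3(b₁+b₂+b₃)) + (a₁+a₂+a₃)(b₁+b₂+b₃)(c₁+c₂+c₃) + 2·Σ_{i=1}^{3} aᵢbᵢcᵢ − Σ_{i≠j} aᵢbⱼcⱼ; in particular det M is a rational number. -/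
open Matrix

theorem det_mu_eq_trilinear_form (ζ : ℂ) (hζ : ζ ^ 2 + ζ + 1 = 0)
    (a₁ a₂ a₃ b₁ b₂ b₃ c₁ c₂ c₃ : ℚ) :
    (!![(a₁ : ℂ) + b₂ + b₃ + c₂ + c₃, -(b₃ : ℂ) - ζ * c₃, -(b₂ : ℂ) - ζ ^ 2 * c₂;
        -(b₃ : ℂ) - ζ ^ 2 * c₃, (a₂ : ℂ) + b₁ + b₃ + c₁ + c₃, -(b₁ : ℂ) - ζ * c₁;
        -(b₂ : ℂ) - ζ * c₂, -(b₁ : ℂ) - ζ ^ 2 * c₁,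
          (a₃ : ℂ) + b₁ + b₂ + c₁ + c₂]).det
    = ((a₁ * a₂ * a₃
        + (a₁ * a₂ * (b₁ + b₂ + c₁ + c₂) + a₁ * a₃ * (b₁ + b₃ + c₁ + c₃)
            + a₂ * a₃ * (b₂ + b₃ + c₂ + c₃))
        + (b₁ * b₂ + b₁ * b₃ + b₂ * b₃) * (a₁ + a₂ + a₃ + 3 * (c₁ + c₂ + c₃))
        + (c₁ * c₂ + c₁ * c₃ + c₂ * c₃) * (a₁ + a₂ + a₃ + 3 * (b₁ + b₂ + b₃))
        + (a₁ + a₂ + a₃) * (b₁ + b₂ + b₃) * (c₁ + c₂ + c₃)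
        + 2 * (a₁ * b₁ * c₁ + a₂ * b₂ * c₂ + a₃ * b₃ * c₃)
        - (a₁ * (b₂ * c₂) + a₁ * (b₃ * c₃) + a₂ * (b₁ * c₁) + a₂ * (b₃ * c₃)
            + a₃ * (b₁ * c₁) + a₃ * (b₂ * c₂)) : ℚ) : ℂ) := by
  rw [det_fin_three]
  simp only [of_apply, cons_val', cons_val_zero, cons_val_one, cons_val]
  push_cast
  grind
end

section
/- Let ζ = e^{2πi/3} ∈ ℂ and ρ = (ζ − ζ²)/3. For all real numbers a₁,a₂,a₃,b₁,b₂,b₃,c₁,c₂,c₃, the matrix Ω = ρ·[[a₁+b₂+b₃+c₂+c₃, −b₃−ζc₃, −b₂−ζ²c₂], [−b₃−ζ²c₃, a₂+b₁+b₃+c₁+c₃, −b₁−ζc₁], [−b₂−ζc₂, −b₁−ζ²c₁, a₃+b₁+b₂+c₁+c₂]] is skew-Hermitian: its conjugate transpose equals −Ω. -/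
open Matrix

noncomputable def ζ : ℂ := Complex.exp (2 * Real.pi * Complex.I / 3)

noncomputable def ρ : ℂ := (ζ - ζ ^ 2) / 3

theorem ζ_pow_three : ζ ^ 3 = 1 := by
  rw [ζ, ← Complex.exp_nat_mul, ← Complex.exp_two_pi_mul_I]
  congr 1
  push_cast
  ring

theorem conj_ζ : (starRingEnd ℂ) ζ = ζ ^ 2 := by
  have hζ : ζ ≠ 0 := Complex.exp_ne_zero _
  have h : (starRingEnd ℂ) ζ * ζ = 1 := by
    rw [ζ, ← Complex.exp_conj, ← Complex.exp_add, ← Complex.exp_zero]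
    congr 1
    rw [map_div₀, map_mul, map_mul, Complex.conj_I, Complex.conj_ofReal, map_ofNat, map_ofNat]
    ring
  exact mul_right_cancel₀ hζ (by rw [h, ← pow_succ, ζ_pow_three])

theorem ζ_sq_sq : (ζ ^ 2) ^ 2 = ζ := by
  linear_combination ζ * ζ_pow_three

theorem conj_ρ : (starRingEnd ℂ) ρ = -ρ := by
  rw [ρ, map_div₀, map_sub, map_pow, conj_ζ, ζ_sq_sq, map_ofNat]
  ring

theorem Omega_skew_hermitian (a₁ a₂ a₃ b₁ b₂ b₃ c₁ c₂ c₃ : ℝ) :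
    (ρ • !![(a₁ : ℂ) + b₂ + b₃ + c₂ + c₃, -(b₃ : ℂ) - ζ * c₃, -(b₂ : ℂ) - ζ ^ 2 * c₂;
            -(b₃ : ℂ) - ζ ^ 2 * c₃, (a₂ : ℂ) + b₁ + b₃ + c₁ + c₃, -(b₁ : ℂ) - ζ * c₁;
            -(b₂ : ℂ) - ζ * c₂, -(b₁ : ℂ) - ζ ^ 2 * c₁,
              (a₃ : ℂ) + b₁ + b₂ + c₁ + c₂]).conjTranspose
    = -(ρ • !![(a₁ : ℂ) + b₂ + b₃ + c₂ + c₃, -(b₃ : ℂ) - ζ * c₃, -(b₂ : ℂ) - ζ ^ 2 * c₂;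
               -(b₃ : ℂ) - ζ ^ 2 * c₃, (a₂ : ℂ) + b₁ + b₃ + c₁ + c₃, -(b₁ : ℂ) - ζ * c₁;
               -(b₂ : ℂ) - ζ * c₂, -(b₁ : ℂ) - ζ ^ 2 * c₁,
                 (a₃ : ℂ) + b₁ + b₂ + c₁ + c₂]) := by
  ext i j
  fin_cases i <;> fin_cases j <;>
    simp [Matrix.conjTranspose_apply, conj_ρ, conj_ζ, ζ_sq_sq]
end

section
/- Let K = ℚ(ζ) be the third cyclotomic field (ζ² + ζ + 1 = 0), let σ be the nontrivial ℚ-algebra automorphism of K (σ(ζ) = ζ²), and let ρ = (ζ − ζ²)/3 ∈ K. The ℚ-linear map μ : ℚ⁹ → Mat₃(K) sending (a₁,a₂,a₃,b₁,b₂,b₃,c₁,c₂,c₃) to ρ·[[a₁+b₂+b₃+c₂+c₃, −b₃−ζc₃, −b₂−ζ²c₂], [−b₃−ζ²c₃, a₂+b₁+b₃+c₁+c₃, −b₁−ζc₁], [−b₂−ζc₂, −b₁−ζ²c₁, a₃+b₁+b₂+c₁+c₂]] is injective, and its image is exactly the ℚ-subspace {H ∈ Mat₃(K) : (entrywise-σ(H))ᵀ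 = −H} of skew-Hermitian matrices. -/
open Matrix

section CubeRootOfUnity

variable {K : Type*} [Field K] [Algebra ℚ K] {ζ : K}

theorem eq_zero_of_add_mul_cubeRoot_eq_zero (hζ : ζ ^ 2 + ζ + 1 = 0) {p q : ℚ}
    (h : algebraMap ℚ K p + ζ * algebraMap ℚ K q = 0) : p = 0 ∧ q = 0 := by
  have hpq : p ^ 2 - p * q + q ^ 2 = 0 := by
    apply (algebraMap ℚ K).injective
    simp only [map_add, map_sub, map_mul, map_pow, map_zero]
    linear_combination (algebraMap ℚ K q) ^ 2 * hζ +
      (algebraMap ℚ K p - (ζ + 1) * algebraMap ℚ K q) * h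
  have hq : q = 0 := by
    have : q ^ 2 = 0 := by nlinarith [sq_nonneg (2 * p - q), sq_nonneg q]
    exact pow_eq_zero_iff two_ne_zero |>.mp this
  subst hq
  exact ⟨by simpa using hpq, rfl⟩

theorem eq_of_add_mul_cubeRoot_eq (hζ : ζ ^ 2 + ζ + 1 = 0) {p q r s : ℚ}
    (h : algebraMap ℚ K p + ζ * algebraMap ℚ K q = algebraMap ℚ K r + ζ * algebraMap ℚ K s) :
    p = r ∧ q = s := by
  have := eq_zero_of_add_mul_cubeRoot_eq_zero hζ (p := p - r) (q := q - s)
    (by simp only [map_sub]; linear_combination h)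
  exact ⟨sub_eq_zero.mp this.1, sub_eq_zero.mp this.2⟩

theorem isPrimitiveRoot_of_sq_add_add_one_eq_zero (hζ : ζ ^ 2 + ζ + 1 = 0) :
    IsPrimitiveRoot ζ 3 := by
  have := algebraRat.charZero K
  rw [← Polynomial.isRoot_cyclotomic_iff_charZero three_pos, Polynomial.cyclotomic_three]
  simpa using hζ

theorem exists_eq_add_mul_cubeRoot [IsCyclotomicExtension {3} ℚ K] (hζ : ζ ^ 2 + ζ + 1 = 0)
    (x : K) : ∃ p q : ℚ, x = algebraMap ℚ K p + ζ * algebraMap ℚ K q := by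
  have hx : x ∈ Algebra.adjoin ℚ {ζ} := by
    rw [IsCyclotomicExtension.adjoin_primitive_root_eq_top
      (isPrimitiveRoot_of_sq_add_add_one_eq_zero hζ)]
    trivial
  induction hx using Algebra.adjoin_induction with
  | mem y hy => exact ⟨0, 1, by simpa using hy⟩
  | algebraMap r => exact ⟨r, 0, by simp⟩
  | add y z _ _ hy hz =>
    obtain ⟨p, q, rfl⟩ := hy
    obtain ⟨r, s, rfl⟩ := hz
    exact ⟨p + r, q + s, by simp only [map_add]; ring⟩
  | mul y z _ _ hy hz =>
    obtain ⟨p, q, rfl⟩ := hy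
    obtain ⟨r, s, rfl⟩ := hz
    refine ⟨p * r - q * s, p * s + q * r - q * s, ?_⟩
    simp only [map_add, map_sub, map_mul]
    linear_combination algebraMap ℚ K q * algebraMap ℚ K s * hζ

theorem eq_algebraMap_of_map_eq_self [IsCyclotomicExtension {3} ℚ K] (hζ : ζ ^ 2 + ζ + 1 = 0)
    {σ : K ≃ₐ[ℚ] K} (hσ : σ ζ = ζ ^ 2) {x : K} (hx : σ x = x) :
    ∃ p : ℚ, x = algebraMap ℚ K p := by
  obtain ⟨p, q, rfl⟩ := exists_eq_add_mul_cubeRoot hζ x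
  simp only [map_add, map_mul, AlgEquiv.commutes, hσ] at hx
  have := (eq_of_add_mul_cubeRoot_eq hζ (p := p - q) (q := -q) (r := p) (s := q)
    (by simp only [map_sub, map_neg]; linear_combination hx - algebraMap ℚ K q * hζ)).2
  have hq : q = 0 := by linarith
  exact ⟨p, by simp [hq]⟩

end CubeRootOfUnity

theorem mu_injective_range_skew_hermitian
    (K : Type*) [Field K] [Algebra ℚ K] [IsCyclotomicExtension {3} ℚ K]
    (ζ : K) (hζ : ζ ^ 2 + ζ + 1 = 0)
    (σ : K ≃ₐ[ℚ] K) (hσ : σ ζ = ζ ^ 2) :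
    let ρ : K := (ζ - ζ ^ 2) / 3
    let μ : (Fin 9 → ℚ) → Matrix (Fin 3) (Fin 3) K := fun v =>
      ρ • !![algebraMap ℚ K (v 0 + v 4 + v 5 + v 7 + v 8),
               -algebraMap ℚ K (v 5) - ζ * algebraMap ℚ K (v 8),
               -algebraMap ℚ K (v 4) - ζ ^ 2 * algebraMap ℚ K (v 7);
             -algebraMap ℚ K (v 5) - ζ ^ 2 * algebraMap ℚ K (v 8),
               algebraMap ℚ K (v 1 + v 3 + v 5 + v 6 + v 8),
               -algebraMap ℚ K (v 3) - ζ * algebraMap ℚ K (v 6);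
             -algebraMap ℚ K (v 4) - ζ * algebraMap ℚ K (v 7),
               -algebraMap ℚ K (v 3) - ζ ^ 2 * algebraMap ℚ K (v 6),
               algebraMap ℚ K (v 2 + v 3 + v 4 + v 6 + v 7)]
    Function.Injective μ ∧
      Set.range μ = {H : Matrix (Fin 3) (Fin 3) K | (H.map ⇑σ)ᵀ = -H} := by
  intro ρ μ
  have := algebraRat.charZero K
  have hρ : ρ ≠ 0 := by
    intro h
    have h3 : (3 : K) ≠ 0 := by norm_num
    have h' : ζ - ζ ^ 2 = 0 := (div_eq_zero_iff.mp h).resolve_right h3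
    apply h3
    linear_combination (ζ ^ 2 - ζ) * h' + (ζ ^ 2 - 3 * ζ + 3) * hζ
  have hσρ : σ ρ = -ρ := by
    simp only [ρ, map_div₀, map_sub, map_pow, hσ, map_ofNat]
    linear_combination (-(ζ ^ 2 - ζ) / 3) * hζ
  have hζ4 : (ζ ^ 2) ^ 2 = ζ := by linear_combination (ζ ^ 2 - ζ) * hζ
  refine ⟨fun v w h => ?_, Set.Subset.antisymm ?_ ?_⟩
  · have key := smul_right_injective _ hρ h
    have entry := fun i j => congrFun (congrFun key i) j
    have e00 := (algebraMap ℚ K).injective (entry 0 0)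
    have e11 := (algebraMap ℚ K).injective (entry 1 1)
    have e22 := (algebraMap ℚ K).injective (entry 2 2)
    have h01 := entry 0 1
    have h20 := entry 2 0
    have h12 := entry 1 2
    simp only [of_apply, cons_val] at h01 h20 h12
    have e01 := eq_of_add_mul_cubeRoot_eq hζ (p := -v 5) (q := -v 8) (r := -w 5) (s := -w 8)
      (by simp only [map_neg]; linear_combination h01)
    have e20 := eq_of_add_mul_cubeRoot_eq hζ (p := -v 4) (q := -v 7) (r := -w 4) (s := -w 7)
      (by simp only [map_neg]; linear_combination h20)
    have e12 := eq_of_add_mul_cubeRoot_eq hζ (p := -v 3) (q := -v 6) (r := -w 3) (s := -w 6)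
      (by simp only [map_neg]; linear_combination h12)
    ext i
    fin_cases i <;> dsimp only [Fin.reduceFinMk, Fin.zero_eta, Fin.mk_one] <;> linarith
  · rintro _ ⟨v, rfl⟩
    ext i j
    fin_cases i <;> fin_cases j <;>
      simp [μ, hσρ, hσ, hζ4, -eq_ratCast]
  · intro H hH
    have entry : ∀ i j, σ (ρ⁻¹ * H i j) = ρ⁻¹ * H j i := by
      intro i j
      have : σ (H i j) = -H j i := congrFun (congrFun hH j) i
      rw [map_mul, map_inv₀, hσρ, this, inv_neg, neg_mul_neg]
    obtain ⟨d₀, h00⟩ := eq_algebraMap_of_map_eq_self hζ hσ (entry 0 0)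
    obtain ⟨d₁, h11⟩ := eq_algebraMap_of_map_eq_self hζ hσ (entry 1 1)
    obtain ⟨d₂, h22⟩ := eq_algebraMap_of_map_eq_self hζ hσ (entry 2 2)
    obtain ⟨p₃, q₃, h01⟩ := exists_eq_add_mul_cubeRoot hζ (ρ⁻¹ * H 0 1)
    obtain ⟨p₂, q₂, h20⟩ := exists_eq_add_mul_cubeRoot hζ (ρ⁻¹ * H 2 0)
    obtain ⟨p₁, q₁, h12⟩ := exists_eq_add_mul_cubeRoot hζ (ρ⁻¹ * H 1 2)
    have h10 := entry 0 1
    have h02 := entry 2 0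
    have h21 := entry 1 2
    simp only [h01, h20, h12, map_add, map_mul, AlgEquiv.commutes, hσ] at h10 h02 h21
    refine ⟨![d₀ + p₂ + p₃ + q₂ + q₃, d₁ + p₁ + p₃ + q₁ + q₃, d₂ + p₁ + p₂ + q₁ + q₂,
      -p₁, -p₂, -p₃, -q₁, -q₂, -q₃], ?_⟩
    have hH' : H = ρ • Matrix.of fun i j => ρ⁻¹ * H i j := by
      ext i j
      simp [mul_inv_cancel_left₀ hρ]
    rw [hH']
    refine congrArg (ρ • ·) ?_
    ext i j
    fin_cases i <;> fin_cases j <;>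
      simp [h00, h11, h22, h01, h20, h12, ← h10, ← h02, ← h21, -eq_ratCast] <;> ring
end

section
/- Let R be a commutative ring and let xᵢ, yᵢ, zᵢ ∈ R for i = 1,2,3 satisfy xᵢ³ + yᵢ³ + zᵢ³ = 0. Define N₀ = z₁x₂x₃, N₁ = z₁x₂y₃, N₂ = z₁y₂x₃, N₃ = z₁y₂y₃, N₄ = x₁z₂x₃, N₅ = x₁z₂y₃, N₆ = y₁z₂x₃, N₇ = y₁z₂y₃, N₈ = x₁x₂z₃, N₉ = x₁y₂z₃, N₁₀ = y₁x₂z₃, N₁₁ = y₁y₂z₃. Then: N₀³+N₁³ = N₈³+N₁₀³, N₂³+N₃³ = N₉³+N₁₁³, N₀³+N₂³ = N₄³+N₆³, N₁³+N₃³ = N₅³+N₇³, N₄³+N₅³ = N₈³+N₉³, and N₆³+N₇³ = N₁₀³+N₁₁³. -/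
theorem m1_cubic_relations {R : Type*} [CommRing R]
    (x₁ y₁ z₁ x₂ y₂ z₂ x₃ y₃ z₃ : R)
    (h₁ : x₁ ^ 3 + y₁ ^ 3 + z₁ ^ 3 = 0)
    (h₂ : x₂ ^ 3 + y₂ ^ 3 + z₂ ^ 3 = 0)
    (h₃ : x₃ ^ 3 + y₃ ^ 3 + z₃ ^ 3 = 0) :
    (z₁ * x₂ * x₃) ^ 3 + (z₁ * x₂ * y₃) ^ 3 = (x₁ * x₂ * z₃) ^ 3 + (y₁ * x₂ * z₃) ^ 3 ∧
    (z₁ * y₂ * x₃) ^ 3 + (z₁ * y₂ * y₃) ^ 3 = (x₁ * y₂ * z₃) ^ 3 + (y₁ * y₂ * z₃) ^ 3 ∧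
    (z₁ * x₂ * x₃) ^ 3 + (z₁ * y₂ * x₃) ^ 3 = (x₁ * z₂ * x₃) ^ 3 + (y₁ * z₂ * x₃) ^ 3 ∧
    (z₁ * x₂ * y₃) ^ 3 + (z₁ * y₂ * y₃) ^ 3 = (x₁ * z₂ * y₃) ^ 3 + (y₁ * z₂ * y₃) ^ 3 ∧
    (x₁ * z₂ * x₃) ^ 3 + (x₁ * z₂ * y₃) ^ 3 = (x₁ * x₂ * z₃) ^ 3 + (x₁ * y₂ * z₃) ^ 3 ∧
    (y₁ * z₂ * x₃) ^ 3 + (y₁ * z₂ * y₃) ^ 3 = (y₁ * x₂ * z₃) ^ 3 + (y₁ * y₂ * z₃) ^ 3 := by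
  refine ⟨?_, ?_, ?_, ?_, ?_, ?_⟩
  · linear_combination (z₁ * x₂) ^ 3 * h₃ - (x₂ * z₃) ^ 3 * h₁
  · linear_combination (z₁ * y₂) ^ 3 * h₃ - (y₂ * z₃) ^ 3 * h₁
  · linear_combination (z₁ * x₃) ^ 3 * h₂ - (z₂ * x₃) ^ 3 * h₁
  · linear_combination (z₁ * y₃) ^ 3 * h₂ - (z₂ * y₃) ^ 3 * h₁
  · linear_combination (x₁ * z₂) ^ 3 * h₃ - (x₁ * z₃) ^ 3 * h₂
  · linear_combination (y₁ * z₂) ^ 3 * h₃ - (y₁ * z₃) ^ 3 * h₂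
end

section
/- Let V be the ℚ-vector space with basis {f₁, f₂, f₃} ∪ {l_{i,j,k} : i,j,k ∈ {1,2,3}} (so dim V = 30), and set A¹_{i,j} = (1/3)(f₁ − Σ_{a=1}^{3} l_{a,i,j}), A²_{i,j} = (1/3)(f₂ − Σ_{a=1}^{3} l_{i,a,j}), A³_{i,j} = (1/3)(f₃ − Σ_{a=1}^{3} l_{i,j,a}) for i, j ∈ {1,2,3}. Then there exist rational numbers λ^k_{i,j} (i, j, k ∈ {1,2,3}), all nonzero, such that Σ_{i,j,k=1}^{3} λ^k_{i,j} · A^k_{i,j} = 0 in V. -/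
/-- The 30-dimensional ℚ-vector space with basis `{f₁,f₂,f₃} ∪ {l_{i,j,k}}`. -/
abbrev V : Type := (Fin 3 ⊕ Fin 3 × Fin 3 × Fin 3) → ℚ

/-- The basis vector `f_k`. -/
def f (k : Fin 3) : V := Pi.single (Sum.inl k) 1

/-- The basis vector `l_{i,j,k}`. -/
def l (i j k : Fin 3) : V := Pi.single (Sum.inr (i, j, k)) 1

/-- The classes `A^k_{i,j}` of the 27 contracted rational curves. -/
def A (k i j : Fin 3) : V :=
  (1 / 3 : ℚ) • (f k - ∑ a : Fin 3,
    l (if k = 0 then a else i)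
      (if k = 0 then i else if k = 1 then a else j)
      (if k = 2 then a else j))

/-- The triples of weights `(w i - 2 w j, 2 w j, -w j)` for `w = (1, 1, -2)`. Each has zero total
sum, and the three weights of the curves meeting `l_{p,q,r}` add up to zero. -/
def relationWeight (k i j : Fin 3) : ℚ :=
  let w : Fin 3 → ℚ := ![1, 1, -2]
  if k = 0 then w i - 2 * w j else if k = 1 then 2 * w j else -w j

theorem A_apply_inl (k i j m : Fin 3) :
    A k i j (Sum.inl m) = if m = k then 1 / 3 else 0 := by
  simp [A, f, l, Pi.single_apply]

theorem A_apply_inr (k i j p q r : Fin 3) :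
    A k i j (Sum.inr (p, q, r)) =
      if (if k = 0 then q else p) = i ∧ (if k = 2 then q else r) = j then -(1 / 3) else 0 := by
  fin_cases k <;>
    simp only [A, f, l, Pi.smul_apply, Pi.sub_apply, Finset.sum_apply, Pi.single_apply] <;>
    simp [Prod.mk.injEq, ite_and] <;> split_ifs <;> simp

theorem exists_relation_all_nonzero :
    ∃ lam : Fin 3 → Fin 3 → Fin 3 → ℚ,
      (∀ k i j, lam k i j ≠ 0) ∧
      ∑ k : Fin 3, ∑ i : Fin 3, ∑ j : Fin 3, lam k i j • A k i j = 0 := by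
  refine ⟨relationWeight, ?_, ?_⟩
  · intro k i j
    fin_cases k <;> fin_cases i <;> fin_cases j <;> norm_num [relationWeight]
  · ext x
    rcases x with m | ⟨p, q, r⟩
    · simp only [Finset.sum_apply, Pi.smul_apply, A_apply_inl, smul_eq_mul, Pi.zero_apply]
      fin_cases m <;> simp [relationWeight, Fin.sum_univ_three] <;> norm_num
    · simp only [Finset.sum_apply, Pi.smul_apply, A_apply_inr, smul_eq_mul, Pi.zero_apply,
        ite_and, mul_ite, mul_zero, Finset.sum_ite_eq, Finset.sum_ite_irrel,
        Finset.sum_const_zero, Finset.mem_univ, if_true]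
      simp [Fin.sum_univ_three, relationWeight]
      ring
end

section
/- Let V be the ℚ-vector space with basis {f₁, f₂, f₃} ∪ {l_{i,j,k} : i,j,k ∈ {1,2,3}} (so dim V = 30), and set A¹_{i,j} = (1/3)(f₁ − Σ_{a=1}^{3} l_{a,i,j}), A²_{i,j} = (1/3)(f₂ − Σ_{a=1}^{3} l_{i,a,j}), A³_{i,j} = (1/3)(f₃ − Σ_{a=1}^{3} l_{i,j,a}). Then the ℚ-span of the 27 vectors {A^k_{i,j} : i,j,k ∈ {1,2,3}} has dimension 21; equivalently, the kernel of the linear map ℚ²⁷ → V, (λ^k_{i,j}) ↦ Σ λ^k_{i,j} A^k_{i,j}, has dimension 6. -/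
/-- The coordinates of a linear combination of the `A k i j` along the `f k`. -/
lemma linearCombination_A_inl (w : Fin 3 × Fin 3 × Fin 3 → ℚ) (k : Fin 3) :
    Fintype.linearCombination ℚ (fun p : Fin 3 × Fin 3 × Fin 3 => A p.1 p.2.1 p.2.2) w
      (Sum.inl k) = 1 / 3 * ∑ i, ∑ j, w (k, i, j) := by
  simp only [Fintype.linearCombination_apply, Finset.sum_apply, Pi.smul_apply, A, f, l,
    Pi.sub_apply, Fintype.sum_prod_type, smul_eq_mul, Pi.single_apply]
  fin_cases k <;> simp [Fin.sum_univ_three] <;> ring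

lemma A_zero_inr (a b i j k : Fin 3) :
    A 0 a b (Sum.inr (i, j, k)) = if j = a then if k = b then -(1 / 3) else 0 else 0 := by
  simp only [A, f, l, Pi.smul_apply, Pi.sub_apply, Finset.sum_apply, Pi.single_apply]
  by_cases h₁ : j = a <;> by_cases h₂ : k = b <;> simp [h₁, h₂]

lemma A_one_inr (a b i j k : Fin 3) :
    A 1 a b (Sum.inr (i, j, k)) = if i = a then if k = b then -(1 / 3) else 0 else 0 := by
  simp only [A, f, l, Pi.smul_apply, Pi.sub_apply, Finset.sum_apply, Pi.single_apply]
  by_cases h₁ : i = a <;> by_cases h₂ : k = b <;> simp [h₁, h₂]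

lemma A_two_inr (a b i j k : Fin 3) :
    A 2 a b (Sum.inr (i, j, k)) = if i = a then if j = b then -(1 / 3) else 0 else 0 := by
  simp only [A, f, l, Pi.smul_apply, Pi.sub_apply, Finset.sum_apply, Pi.single_apply]
  by_cases h₁ : i = a <;> by_cases h₂ : j = b <;> simp [h₁, h₂]

/-- The coordinates of a linear combination of the `A k i j` along the `l i j k`. -/
lemma linearCombination_A_inr (w : Fin 3 × Fin 3 × Fin 3 → ℚ) (i j k : Fin 3) :
    Fintype.linearCombination ℚ (fun p : Fin 3 × Fin 3 × Fin 3 => A p.1 p.2.1 p.2.2) w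
      (Sum.inr (i, j, k)) = -(1 / 3) * (w (0, j, k) + w (1, i, k) + w (2, i, j)) := by
  rw [Fintype.linearCombination_apply, Finset.sum_apply, Fintype.sum_prod_type,
    Fin.sum_univ_three]
  simp only [Fintype.sum_prod_type, Pi.smul_apply, smul_eq_mul, A_zero_inr, A_one_inr,
    A_two_inr, mul_ite, mul_zero, Finset.sum_ite_irrel, Finset.sum_const_zero,
    Finset.sum_ite_eq, Finset.mem_univ, if_true]
  ring

/-- A function on two points, extended to three points so that its values sum to zero. -/
def extendSumZero : (Fin 2 → ℚ) →ₗ[ℚ] (Fin 3 → ℚ) where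
  toFun a := ![a 0, a 1, -a 0 - a 1]
  map_add' a b := by ext i; fin_cases i <;> simp; ring
  map_smul' c a := by ext i; fin_cases i <;> simp; ring

lemma extendSumZero_apply (a : Fin 2 → ℚ) : extendSumZero a = ![a 0, a 1, -a 0 - a 1] := rfl

lemma sum_extendSumZero (a : Fin 2 → ℚ) : ∑ i, extendSumZero a i = 0 := by
  simp [extendSumZero_apply, Fin.sum_univ_three]

lemma extendSumZero_restrict {g : Fin 3 → ℚ} (hg : ∑ i, g i = 0) :
    extendSumZero ![g 0, g 1] = g := by
  rw [Fin.sum_univ_three] at hg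
  ext i
  fin_cases i <;> simp [extendSumZero_apply]
  linarith

/-- The parametrization of the linear relations between the `A k i j` by triples of functions
with sum zero. -/
def relation : (Fin 3 → Fin 2 → ℚ) →ₗ[ℚ] (Fin 3 × Fin 3 × Fin 3 → ℚ) where
  toFun v p := ![extendSumZero (v 1) p.2.1 - extendSumZero (v 2) p.2.2,
    extendSumZero (v 2) p.2.2 - extendSumZero (v 0) p.2.1,
    extendSumZero (v 0) p.2.1 - extendSumZero (v 1) p.2.2] p.1
  map_add' u v := by
    ext ⟨k, i, j⟩
    fin_cases k <;> simp <;> ring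
  map_smul' c v := by
    ext ⟨k, i, j⟩
    fin_cases k <;> simp <;> ring

lemma relation_apply (v : Fin 3 → Fin 2 → ℚ) (k i j : Fin 3) :
    relation v (k, i, j) = ![extendSumZero (v 1) i - extendSumZero (v 2) j,
      extendSumZero (v 2) j - extendSumZero (v 0) i,
      extendSumZero (v 0) i - extendSumZero (v 1) j] k := rfl

lemma relation_injective : Function.Injective relation := by
  rw [← LinearMap.ker_eq_bot, LinearMap.ker_eq_bot']
  intro v hv
  have h (k i j : Fin 3) : relation v (k, i, j) = 0 := by rw [hv]; rfl
  have h₀ (i j : Fin 3) := h 0 i j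
  have h₂ (i j : Fin 3) := h 2 i j
  simp only [relation_apply, extendSumZero_apply, Fin.forall_fin_succ] at h₀ h₂
  simp at h₀ h₂
  ext a b
  fin_cases a <;> fin_cases b <;> simp <;> linarith

lemma range_relation : LinearMap.range relation = LinearMap.ker
    (Fintype.linearCombination ℚ fun p : Fin 3 × Fin 3 × Fin 3 => A p.1 p.2.1 p.2.2) := by
  apply le_antisymm
  · rintro _ ⟨v, rfl⟩
    rw [LinearMap.mem_ker]
    ext (k | ⟨i, j, k⟩)
    · rw [linearCombination_A_inl]
      fin_cases k <;> simp [relation_apply, Finset.sum_sub_distrib, ← Finset.mul_sum,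
        sum_extendSumZero]
    · rw [linearCombination_A_inr]
      simp [relation_apply]
  · intro w hw
    rw [LinearMap.mem_ker] at hw
    have hf (k : Fin 3) : ∑ i, ∑ j, w (k, i, j) = 0 := by
      have := linearCombination_A_inl w k
      rw [hw, Pi.zero_apply] at this
      linarith
    have hl (i j k : Fin 3) : w (0, j, k) + w (1, i, k) + w (2, i, j) = 0 := by
      have := linearCombination_A_inr w i j k
      rw [hw, Pi.zero_apply] at this
      linarith
    let g₀ (i : Fin 3) : ℚ := 1 / 3 * ∑ j, w (2, i, j)
    let g₁ (i : Fin 3) : ℚ := 1 / 3 * ∑ j, w (0, i, j)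
    let g₂ (j : Fin 3) : ℚ := 1 / 3 * ∑ i, w (1, i, j)
    have e₀ : extendSumZero ![g₀ 0, g₀ 1] = g₀ :=
      extendSumZero_restrict (by simp only [g₀, ← Finset.mul_sum, hf, mul_zero])
    have e₁ : extendSumZero ![g₁ 0, g₁ 1] = g₁ :=
      extendSumZero_restrict (by simp only [g₁, ← Finset.mul_sum, hf, mul_zero])
    have e₂ : extendSumZero ![g₂ 0, g₂ 1] = g₂ := extendSumZero_restrict (by
      simp only [g₂, ← Finset.mul_sum]; rw [Finset.sum_comm, hf, mul_zero])
    refine ⟨![![g₀ 0, g₀ 1], ![g₁ 0, g₁ 1], ![g₂ 0, g₂ 1]], ?_⟩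
    have hf' := hf
    simp only [Fin.sum_univ_three] at hf'
    have f₀ := hf' 0
    have f₁ := hf' 1
    have f₂ := hf' 2
    ext ⟨k, i, j⟩
    rw [relation_apply]
    simp only [Matrix.cons_val, e₀, e₁, e₂]
    fin_cases k <;> simp [g₀, g₁, g₂, Fin.sum_univ_three]
    · linarith [hl 0 i j, hl 1 i j, hl 2 i j, hl 0 i 0, hl 0 i 1, hl 0 i 2, hl 1 i 0, hl 1 i 1,
        hl 1 i 2, hl 2 i 0, hl 2 i 1, hl 2 i 2]
    · linarith [hl i 0 j, hl i 1 j, hl i 2 j, hl 0 0 j, hl 0 1 j, hl 0 2 j, hl 1 0 j, hl 1 1 j,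
        hl 1 2 j, hl 2 0 j, hl 2 1 j, hl 2 2 j]
    · linarith [hl i j 0, hl i j 1, hl i j 2, hl i 0 0, hl i 0 1, hl i 0 2, hl i 1 0, hl i 1 1,
        hl i 1 2, hl i 2 0, hl i 2 1, hl i 2 2, hl 0 j 0, hl 0 j 1, hl 0 j 2, hl 1 j 0, hl 1 j 1,
        hl 1 j 2, hl 2 j 0, hl 2 j 1, hl 2 j 2]

theorem span_A_rank_eq_21 :
    Module.finrank ℚ (Submodule.span ℚ
      (Set.range fun p : Fin 3 × Fin 3 × Fin 3 => A p.1 p.2.1 p.2.2)) = 21 := by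
  have h := LinearMap.finrank_range_add_finrank_ker
    (Fintype.linearCombination ℚ fun p : Fin 3 × Fin 3 × Fin 3 => A p.1 p.2.1 p.2.2)
  rw [← range_relation, LinearMap.finrank_range_of_inj relation_injective,
    Fintype.range_linearCombination] at h
  simp [Module.finrank_pi_fintype] at h
  omega
end

section
/- Let V be the ℚ-vector space with basis {f₁, f₂, f₃} ∪ {l_{i,j,k} : i,j,k ∈ {1,2,3}} (so dim V = 30), and set A¹_{i,j} = (1/3)(f₁ − Σ_{a=1}^{3} l_{a,i,j}) and A²_{i,j} = (1/3)(f₂ − Σ_{a=1}^{3} l_{i,a,j}) for i, j ∈ {1,2,3}. Then there exist rational numbers λ^k_{i,j} (k ∈ {1,2}, i, j ∈ {1,2,3}), all nonzero, such that Σ_{k=1}^{2} Σ_{i,j=1}^{3} λ^k_{i,j} · A^k_{i,j} = 0 in V. -/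
theorem exists_relation_all_nonzero_18 :
    ∃ lam : Fin 2 → Fin 3 → Fin 3 → ℚ,
      (∀ k i j, lam k i j ≠ 0) ∧
      ∑ k : Fin 2, ∑ i : Fin 3, ∑ j : Fin 3,
        lam k i j • A (Fin.castLE (by norm_num) k) i j = 0 := by
  refine ⟨fun k _ j => (if k = 0 then 1 else -1) * (if j = 2 then -2 else 1), ?_, ?_⟩
  · intro k i j
    dsimp only
    split_ifs <;> norm_num
  · have h0 : Fin.castLE (by norm_num : 2 ≤ 3) 0 = 0 := rfl
    have h1 : Fin.castLE (by norm_num : 2 ≤ 3) 1 = 1 := rfl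
    simp only [Fin.sum_univ_two, Fin.sum_univ_three, h0, h1, A, Fin.reduceEq, if_true, if_false]
    module
end

section
/- In ℂ¹² with coordinates N₀,…,N₁₁, consider the fifteen quadrics Q₁ = N₀N₃−N₁N₂, Q₂ = N₀N₅−N₁N₄, Q₃ = N₀N₇−N₁N₆, Q₄ = N₀N₉−N₂N₈, Q₅ = N₀N₁₁−N₂N₁₀, Q₆ = N₁N₉−N₃N₈, Q₇ = N₁N₁₁−N₃N₁₀, Q₈ = N₂N₅−N₃N₄, Q₉ = N₂N₇−N₃N₆, Q₁₀ = N₄N₇−N₅N₆, Q₁₁ = N₄N₁₀−N₆N₈, Q₁₂ = N₄N₁₁−N₆N₉, Q₁₃ = N₅N₁₀−N₇N₈, Q₁₄ = N₅N₁₁−N₇N₉, Q₁₅ = N₈N₁₁−N₉N₁₀ and the six cubics C₁ = N₀³+N₁³−N₈³−N₁₀³, C₂ = N₂³+N₃³−N₉³−N₁₁³, C₃ = N₀³+N₂³−N₄³−N₆³, C₄ = N₁³+N₃³−N₅³−N₇³, C₅ = N₄³+N₅³−N₈³−N₉³, C₆ = N₆³+N₇³−N₁₀³−N₁₁³. At the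 point p = (0,0,0,0,0,0,0,0,1,−1,−1,1), the intersection of the kernels of the differentials (gradient covectors) at p of all 21 polynomials is exactly the 5-dimensional complex subspace {(a, b, −a, −b, c, d, −c, −d, e, −e, −e, e) : a,b,c,d,e ∈ ℂ} ⊂ ℂ¹². -/
/-! The fifteen quadrics and six cubics containing `m₁(E³) ⊂ ℙ¹¹`. -/

def Q₁ : (Fin 12 → ℂ) → ℂ := fun N => N 0 * N 3 - N 1 * N 2
def Q₂ : (Fin 12 → ℂ) → ℂ := fun N => N 0 * N 5 - N 1 * N 4
def Q₃ : (Fin 12 → ℂ) → ℂ := fun N => N 0 * N 7 - N 1 * N 6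
def Q₄ : (Fin 12 → ℂ) → ℂ := fun N => N 0 * N 9 - N 2 * N 8
def Q₅ : (Fin 12 → ℂ) → ℂ := fun N => N 0 * N 11 - N 2 * N 10
def Q₆ : (Fin 12 → ℂ) → ℂ := fun N => N 1 * N 9 - N 3 * N 8
def Q₇ : (Fin 12 → ℂ) → ℂ := fun N => N 1 * N 11 - N 3 * N 10
def Q₈ : (Fin 12 → ℂ) → ℂ := fun N => N 2 * N 5 - N 3 * N 4
def Q₉ : (Fin 12 → ℂ) → ℂ := fun N => N 2 * N 7 - N 3 * N 6
def Q₁₀ : (Fin 12 → ℂ) → ℂ := fun N => N 4 * N 7 - N 5 * N 6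
def Q₁₁ : (Fin 12 → ℂ) → ℂ := fun N => N 4 * N 10 - N 6 * N 8
def Q₁₂ : (Fin 12 → ℂ) → ℂ := fun N => N 4 * N 11 - N 6 * N 9
def Q₁₃ : (Fin 12 → ℂ) → ℂ := fun N => N 5 * N 10 - N 7 * N 8
def Q₁₄ : (Fin 12 → ℂ) → ℂ := fun N => N 5 * N 11 - N 7 * N 9
def Q₁₅ : (Fin 12 → ℂ) → ℂ := fun N => N 8 * N 11 - N 9 * N 10
def C₁ : (Fin 12 → ℂ) → ℂ := fun N => N 0 ^ 3 + N 1 ^ 3 - N 8 ^ 3 - N 10 ^ 3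
def C₂ : (Fin 12 → ℂ) → ℂ := fun N => N 2 ^ 3 + N 3 ^ 3 - N 9 ^ 3 - N 11 ^ 3
def C₃ : (Fin 12 → ℂ) → ℂ := fun N => N 0 ^ 3 + N 2 ^ 3 - N 4 ^ 3 - N 6 ^ 3
def C₄ : (Fin 12 → ℂ) → ℂ := fun N => N 1 ^ 3 + N 3 ^ 3 - N 5 ^ 3 - N 7 ^ 3
def C₅ : (Fin 12 → ℂ) → ℂ := fun N => N 4 ^ 3 + N 5 ^ 3 - N 8 ^ 3 - N 9 ^ 3
def C₆ : (Fin 12 → ℂ) → ℂ := fun N => N 6 ^ 3 + N 7 ^ 3 - N 10 ^ 3 - N 11 ^ 3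

/-- The image of the contracted curve `C³₃,₃`. -/
def p : Fin 12 → ℂ := ![0, 0, 0, 0, 0, 0, 0, 0, 1, -1, -1, 1]

lemma fderiv_coord_mul_sub_mul {n : ℕ} (i j k l : Fin n) (x v : Fin n → ℂ) :
    fderiv ℂ (fun N : Fin n → ℂ => N i * N j - N k * N l) x v =
      x i * v j + x j * v i - (x k * v l + x l * v k) := by
  have h (m : Fin n) : HasFDerivAt (fun N : Fin n → ℂ => N m)
      (ContinuousLinearMap.proj (R := ℂ) (φ := fun _ : Fin n => ℂ) m) x := hasFDerivAt_apply m x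
  have hd := ((h i).fun_mul (h j)).fun_sub ((h k).fun_mul (h l))
  rw [hd.fderiv]
  simp

lemma fderiv_coord_cubes {n : ℕ} (i j k l : Fin n) (x v : Fin n → ℂ) :
    fderiv ℂ (fun N : Fin n → ℂ => N i ^ 3 + N j ^ 3 - N k ^ 3 - N l ^ 3) x v =
      3 * (x i ^ 2 * v i + x j ^ 2 * v j - x k ^ 2 * v k - x l ^ 2 * v l) := by
  have h (m : Fin n) : HasFDerivAt (fun N : Fin n → ℂ => N m)
      (ContinuousLinearMap.proj (R := ℂ) (φ := fun _ : Fin n => ℂ) m) x := hasFDerivAt_apply m x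
  have hd := ((((h i).pow 3).fun_add ((h j).pow 3)).fun_sub
    ((h k).pow 3)).fun_sub ((h l).pow 3)
  rw [hd.fderiv]
  simp
  ring

/-- The common kernel of the differentials at `p` of the 21 equations of `m₁(E³)` is the
5-dimensional subspace `{(a, b, -a, -b, c, d, -c, -d, e, -e, -e, e)}`. -/
theorem tangent_space_at_node (v : Fin 12 → ℂ) :
    (fderiv ℂ Q₁ p v = 0 ∧ fderiv ℂ Q₂ p v = 0 ∧ fderiv ℂ Q₃ p v = 0 ∧
     fderiv ℂ Q₄ p v = 0 ∧ fderiv ℂ Q₅ p v = 0 ∧ fderiv ℂ Q₆ p v = 0 ∧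
     fderiv ℂ Q₇ p v = 0 ∧ fderiv ℂ Q₈ p v = 0 ∧ fderiv ℂ Q₉ p v = 0 ∧
     fderiv ℂ Q₁₀ p v = 0 ∧ fderiv ℂ Q₁₁ p v = 0 ∧ fderiv ℂ Q₁₂ p v = 0 ∧
     fderiv ℂ Q₁₃ p v = 0 ∧ fderiv ℂ Q₁₄ p v = 0 ∧ fderiv ℂ Q₁₅ p v = 0 ∧
     fderiv ℂ C₁ p v = 0 ∧ fderiv ℂ C₂ p v = 0 ∧ fderiv ℂ C₃ p v = 0 ∧
     fderiv ℂ C₄ p v = 0 ∧ fderiv ℂ C₅ p v = 0 ∧ fderiv ℂ C₆ p v = 0) ↔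
    ∃ a b c d e : ℂ, v = ![a, b, -a, -b, c, d, -c, -d, e, -e, -e, e] := by
  have hp : p 0 = 0 ∧ p 1 = 0 ∧ p 2 = 0 ∧ p 3 = 0 ∧ p 4 = 0 ∧ p 5 = 0 ∧ p 6 = 0 ∧ p 7 = 0 ∧
      p 8 = 1 ∧ p 9 = -1 ∧ p 10 = -1 ∧ p 11 = 1 :=
    ⟨rfl, rfl, rfl, rfl, rfl, rfl, rfl, rfl, rfl, rfl, rfl, rfl⟩
  obtain ⟨h0, h1, h2, h3, h4, h5, h6, h7, h8, h9, h10, h11⟩ := hp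
  unfold Q₁ Q₂ Q₃ Q₄ Q₅ Q₆ Q₇ Q₈ Q₉ Q₁₀ Q₁₁ Q₁₂ Q₁₃ Q₁₄ Q₁₅ C₁ C₂ C₃ C₄ C₅ C₆
  simp only [fderiv_coord_mul_sub_mul, fderiv_coord_cubes,
    h0, h1, h2, h3, h4, h5, h6, h7, h8, h9, h10, h11]
  constructor
  · rintro ⟨-, -, -, q4, -, q6, -, -, -, -, q11, -, q13, -, -, c1, c2, -, -, c5, -⟩
    refine ⟨v 0, v 1, v 4, v 5, v 8, ?_⟩
    ext i
    fin_cases i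
    · rfl
    · rfl
    · change v 2 = -v 0
      linear_combination -q4
    · change v 3 = -v 1
      linear_combination -q6
    · rfl
    · rfl
    · change v 6 = -v 4
      linear_combination -q11
    · change v 7 = -v 5
      linear_combination -q13
    · rfl
    · change v 9 = -v 8
      linear_combination (-1 / 3) * c5
    · change v 10 = -v 8
      linear_combination (-1 / 3) * c1
    · change v 11 = v 8
      linear_combination (-1 / 3) * c2 + (1 / 3) * c5
  · rintro ⟨a, b, c, d, e, rfl⟩
    simp
end
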